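/- Let K = (K_n)_{n≥1} be a matrix convex set in V and let F ⊆ K_n be a nonempty matrix exposed face of K with exposing pair (Φ, α). Set N := ∩_{A ∈ F} ker(α ⊗ I_n − Re Φ_n(A)) ⊆ ℂ^n ⊗ ℂ^n. Then for every nonzero x ∈ N, writing x = Σ_{i=1}^n x_i ⊗ e_i with x_i ∈ ℂ^n, the vectors x_1, …, x_n span ℂ^n; moreover, N is one-dimensional. -/

import Mathlib

open scoped Matrix Kronecker ComplexOrder

noncomputable section

variable {V : Type*} [AddCommGroup V] [Module ℂ V]

/-- The matrix `γ* A γ` computed entrywise via the `ℂ`-action on `V`. -/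
def mconj {m n : ℕ} (γ : Matrix (Fin m) (Fin n) ℂ)
    (A : Matrix (Fin m) (Fin m) V) : Matrix (Fin n) (Fin n) V :=
  Matrix.of fun i j => ∑ k, ∑ l, (star (γ k i) * γ l j) • A k l

/-- A graded family `K = (K_n)` is a matrix convex set. -/
def IsMatrixConvex (K : ∀ n : ℕ, Set (Matrix (Fin n) (Fin n) V)) : Prop :=
  ∀ (k n : ℕ), 0 < k → 0 < n →
    ∀ (ns : Fin k → ℕ) (A : ∀ i : Fin k, Matrix (Fin (ns i)) (Fin (ns i)) V)
      (γ : ∀ i : Fin k, Matrix (Fin (ns i)) (Fin n) ℂ),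
      (∀ i, 0 < ns i) → (∀ i, A i ∈ K (ns i)) →
      (∑ i, (γ i)ᴴ * γ i) = 1 →
      (∑ i, mconj (γ i) (A i)) ∈ K n

/-- The `r`-th ampliation of `Φ : V → M_m(ℂ)` applied to `B ∈ M_r(V)`, as a matrix
indexed by `Fin m × Fin r` (block `(i,j)`, inner indices `(p,q)` ↦ `Φ (B i j) p q`). -/
def amplify {m r : ℕ} (Φ : V → Matrix (Fin m) (Fin m) ℂ)
    (B : Matrix (Fin r) (Fin r) V) : Matrix (Fin m × Fin r) (Fin m × Fin r) ℂ :=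
  Matrix.of fun p q => Φ (B p.2 q.2) p.1 q.1

/-- Hermitian part `(X + X*)/2` of a complex matrix. -/
def reM {ι : Type*} (X : Matrix ι ι ℂ) : Matrix ι ι ℂ := (2 : ℂ)⁻¹ • (X + Xᴴ)

section Top

variable [TopologicalSpace V]

/-- `(Φ, α)` matricially exposes the point `A ∈ K_n`. -/
def IsExposingPair (K : ∀ n : ℕ, Set (Matrix (Fin n) (Fin n) V)) {n : ℕ}
    (A : Matrix (Fin n) (Fin n) V)
    (Φ : V →L[ℂ] Matrix (Fin n) (Fin n) ℂ) (α : Matrix (Fin n) (Fin n) ℂ) : Prop :=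
  α.IsHermitian ∧
  (∀ r : ℕ, 0 < r → ∀ B ∈ K r,
    (α ⊗ₖ (1 : Matrix (Fin r) (Fin r) ℂ) - reM (amplify (⇑Φ) B)).PosSemidef) ∧
  {B | B ∈ K n ∧
      (α ⊗ₖ (1 : Matrix (Fin n) (Fin n) ℂ) - reM (amplify (⇑Φ) B)).PosSemidef ∧
      ¬ IsUnit (α ⊗ₖ (1 : Matrix (Fin n) (Fin n) ℂ) - reM (amplify (⇑Φ) B))} =
    {B | ∃ U ∈ Matrix.unitaryGroup (Fin n) ℂ, B = mconj U A}

/-- `A ∈ K_n` is a matrix exposed point of `K`. -/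
def IsMatrixExposed (K : ∀ n : ℕ, Set (Matrix (Fin n) (Fin n) V)) {n : ℕ}
    (A : Matrix (Fin n) (Fin n) V) : Prop :=
  ∃ (Φ : V →L[ℂ] Matrix (Fin n) (Fin n) ℂ) (α : Matrix (Fin n) (Fin n) ℂ),
    IsExposingPair K A Φ α

end Top

/-- Classical exposed point of a set in a topological `ℂ`-vector space. -/
def IsExposedPoint {W : Type*} [AddCommGroup W] [Module ℂ W] [TopologicalSpace W]
    (C : Set W) (x : W) : Prop :=
  x ∈ C ∧ ∃ (φ : W →L[ℂ] ℂ) (a : ℝ),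
    (φ x).re = a ∧ ∀ y ∈ C, y ≠ x → (φ y).re < a

/-- Classical exposed face of a set in a topological `ℂ`-vector space. -/
def IsExposedFaceOf {W : Type*} [AddCommGroup W] [Module ℂ W] [TopologicalSpace W]
    (C F : Set W) : Prop :=
  F ⊆ C ∧ ∃ (φ : W →L[ℂ] ℂ) (a : ℝ),
    (∀ x ∈ F, (φ x).re = a) ∧ ∀ y ∈ C, y ∉ F → (φ y).re < a

/-- `A ∈ K_n` is a matrix extreme point of the graded family `K`. -/
def IsMatrixExtreme (K : ∀ n : ℕ, Set (Matrix (Fin n) (Fin n) V)) {n : ℕ}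
    (A : Matrix (Fin n) (Fin n) V) : Prop :=
  A ∈ K n ∧
  ∀ (k : ℕ), 0 < k →
    ∀ (ns : Fin k → ℕ) (Ai : ∀ i : Fin k, Matrix (Fin (ns i)) (Fin (ns i)) V)
      (γ : ∀ i : Fin k, Matrix (Fin (ns i)) (Fin n) ℂ),
      (∀ i, 0 < ns i) → (∀ i, Ai i ∈ K (ns i)) →
      (∀ i, Function.Surjective (γ i).mulVec) →
      (∑ i, (γ i)ᴴ * γ i) = 1 →
      (∑ i, mconj (γ i) (Ai i)) = A →
      ∀ i, ∃ (h : ns i = n) (U : Matrix (Fin n) (Fin n) ℂ),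
        U ∈ Matrix.unitaryGroup (Fin n) ℂ ∧
        Matrix.reindex (finCongr h) (finCongr h) (Ai i) = mconj U A

/-- `Γ_n(K)`. -/
def GammaSet (K : ∀ n : ℕ, Set (Matrix (Fin n) (Fin n) V)) (n : ℕ) :
    Set (Matrix (Fin n) (Fin n) ℂ × Matrix (Fin n) (Fin n) V) :=
  {P | ∃ (k : ℕ), 0 < k ∧ ∃ (A : Matrix (Fin k) (Fin k) V) (γ : Matrix (Fin k) (Fin n) ℂ),
    A ∈ K k ∧ (γᴴ * γ).trace = 1 ∧ P = (γᴴ * γ, mconj γ A)}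

/-- Matrix face `F ⊆ K_n`. -/
def IsMatrixFace (K : ∀ n : ℕ, Set (Matrix (Fin n) (Fin n) V)) {n : ℕ}
    (F : Set (Matrix (Fin n) (Fin n) V)) : Prop :=
  F ⊆ K n ∧ Convex ℝ F ∧
  ∀ (k : ℕ), 0 < k →
    ∀ (ns : Fin k → ℕ) (Ai : ∀ i : Fin k, Matrix (Fin (ns i)) (Fin (ns i)) V)
      (γ : ∀ i : Fin k, Matrix (Fin (ns i)) (Fin n) ℂ),
      (∀ i, 0 < ns i) → (∀ i, Ai i ∈ K (ns i)) →
      (∀ i, Function.Surjective (γ i).mulVec) →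
      (∑ i, (γ i)ᴴ * γ i) = 1 →
      (∑ i, mconj (γ i) (Ai i)) ∈ F →
      ∀ i, ∃ h : ns i = n, Matrix.reindex (finCongr h) (finCongr h) (Ai i) ∈ F

/-- `A` is a `C*`-extreme point of `F ⊆ M_n(V)`. -/
def IsCStarExtreme {n : ℕ} (F : Set (Matrix (Fin n) (Fin n) V))
    (A : Matrix (Fin n) (Fin n) V) : Prop :=
  A ∈ F ∧
  ∀ (k : ℕ), 0 < k →
    ∀ (Ai : Fin k → Matrix (Fin n) (Fin n) V) (γ : Fin k → Matrix (Fin n) (Fin n) ℂ),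
      (∀ i, Ai i ∈ F) → (∀ i, IsUnit (γ i)) →
      (∑ i, (γ i)ᴴ * γ i) = 1 →
      (∑ i, mconj (γ i) (Ai i)) = A →
      ∀ i, ∃ U ∈ Matrix.unitaryGroup (Fin n) ℂ, Ai i = mconj U A

section Top2

variable [TopologicalSpace V]

/-- `(Φ, α)` is an exposing pair for the face `F ⊆ K_n`. -/
def IsFaceExposingPair (K : ∀ n : ℕ, Set (Matrix (Fin n) (Fin n) V)) {n : ℕ}
    (F : Set (Matrix (Fin n) (Fin n) V))
    (Φ : V →L[ℂ] Matrix (Fin n) (Fin n) ℂ) (α : Matrix (Fin n) (Fin n) ℂ) : Prop :=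
  α.IsHermitian ∧
  (∀ m : ℕ, 0 < m → ∀ B ∈ K m,
    (α ⊗ₖ (1 : Matrix (Fin m) (Fin m) ℂ) - reM (amplify (⇑Φ) B)).PosSemidef) ∧
  (∀ m : ℕ, 0 < m → m < n → ∀ B ∈ K m,
    (α ⊗ₖ (1 : Matrix (Fin m) (Fin m) ℂ) - reM (amplify (⇑Φ) B)).PosDef) ∧
  {B | B ∈ K n ∧
      (α ⊗ₖ (1 : Matrix (Fin n) (Fin n) ℂ) - reM (amplify (⇑Φ) B)).PosSemidef ∧
      ¬ IsUnit (α ⊗ₖ (1 : Matrix (Fin n) (Fin n) ℂ) - reM (amplify (⇑Φ) B))} = F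

/-- `F ⊆ K_n` is a matrix exposed face of `K`. -/
def IsMatrixExposedFace (K : ∀ n : ℕ, Set (Matrix (Fin n) (Fin n) V)) {n : ℕ}
    (F : Set (Matrix (Fin n) (Fin n) V)) : Prop :=
  F ⊆ K n ∧ Convex ℝ F ∧
  ∃ (Φ : V →L[ℂ] Matrix (Fin n) (Fin n) ℂ) (α : Matrix (Fin n) (Fin n) ℂ),
    IsFaceExposingPair K F Φ α

/-- The unitary orbit of `F ⊆ M_n(V)`. -/
def unitaryOrbit {n : ℕ} (F : Set (Matrix (Fin n) (Fin n) V)) :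
    Set (Matrix (Fin n) (Fin n) V) :=
  {B | ∃ A ∈ F, ∃ U ∈ Matrix.unitaryGroup (Fin n) ℂ, B = mconj U A}

/-- `F ⊆ K_n` is a weak matrix exposed face of `K`. -/
def IsWeakMatrixExposedFace (K : ∀ n : ℕ, Set (Matrix (Fin n) (Fin n) V)) {n : ℕ}
    (F : Set (Matrix (Fin n) (Fin n) V)) : Prop :=
  F ⊆ K n ∧ Convex ℝ F ∧
  ∃ (Φ : V →L[ℂ] Matrix (Fin n) (Fin n) ℂ) (α : Matrix (Fin n) (Fin n) ℂ),
    α.IsHermitian ∧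
    (∀ m : ℕ, 0 < m → ∀ B ∈ K m,
      (α ⊗ₖ (1 : Matrix (Fin m) (Fin m) ℂ) - reM (amplify (⇑Φ) B)).PosSemidef) ∧
    (∀ m : ℕ, 0 < m → m < n → ∀ B ∈ K m,
      (α ⊗ₖ (1 : Matrix (Fin m) (Fin m) ℂ) - reM (amplify (⇑Φ) B)).PosDef) ∧
    {B | B ∈ K n ∧
        (α ⊗ₖ (1 : Matrix (Fin n) (Fin n) ℂ) - reM (amplify (⇑Φ) B)).PosSemidef ∧
        ¬ IsUnit (α ⊗ₖ (1 : Matrix (Fin n) (Fin n) ℂ) - reM (amplify (⇑Φ) B))} =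
      unitaryOrbit F

end Top2

/-- `F = (F_n)` is a matrix multiface of `K`. -/
def IsMatrixMultiface (K F : ∀ n : ℕ, Set (Matrix (Fin n) (Fin n) V)) : Prop :=
  (∀ n, F n ⊆ K n) ∧ (∀ n, Convex ℝ (F n)) ∧
  ∀ (k n : ℕ), 0 < k → 0 < n →
    ∀ (ns : Fin k → ℕ) (Ai : ∀ i : Fin k, Matrix (Fin (ns i)) (Fin (ns i)) V)
      (γ : ∀ i : Fin k, Matrix (Fin (ns i)) (Fin n) ℂ),
      (∀ i, 0 < ns i) → (∀ i, Ai i ∈ K (ns i)) →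
      (∀ i, Function.Surjective (γ i).mulVec) →
      (∑ i, (γ i)ᴴ * γ i) = 1 →
      (∑ i, mconj (γ i) (Ai i)) ∈ F n →
      ∀ i, Ai i ∈ F (ns i)

section Top3

variable [TopologicalSpace V]

/-- `F = (F_n)` is a matrix exposed multiface of `K`. -/
def IsMatrixExposedMultiface (K F : ∀ n : ℕ, Set (Matrix (Fin n) (Fin n) V)) : Prop :=
  (∀ n, F n ⊆ K n) ∧ (∀ n, Convex ℝ (F n)) ∧
  ∃ (r : ℕ), 0 < r ∧
    ∃ (Φ : V →L[ℂ] Matrix (Fin r) (Fin r) ℂ) (α : Matrix (Fin r) (Fin r) ℂ),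
      α.IsHermitian ∧
      (∀ n : ℕ, 0 < n → ∀ B ∈ K n,
        (α ⊗ₖ (1 : Matrix (Fin n) (Fin n) ℂ) - reM (amplify (⇑Φ) B)).PosSemidef) ∧
      (∀ n : ℕ, 0 < n →
        {B | B ∈ K n ∧
            (α ⊗ₖ (1 : Matrix (Fin n) (Fin n) ℂ) - reM (amplify (⇑Φ) B)).PosSemidef ∧
            ¬ IsUnit (α ⊗ₖ (1 : Matrix (Fin n) (Fin n) ℂ) - reM (amplify (⇑Φ) B))} = F n)

end Top3

end

section PencilLemmas

variable {V : Type*} [AddCommGroup V] [Module ℂ V]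

theorem IsMatrixConvex.mconj_mem {K : ∀ n : ℕ, Set (Matrix (Fin n) (Fin n) V)}
    (hK : IsMatrixConvex K) {m n : ℕ} (hm : 0 < m) (hn : 0 < n)
    {A : Matrix (Fin m) (Fin m) V} (hA : A ∈ K m)
    {γ : Matrix (Fin m) (Fin n) ℂ} (hγ : γᴴ * γ = 1) : mconj γ A ∈ K n := by
  simpa using hK 1 n one_pos hn (fun _ => m) (fun _ => A) (fun _ => γ)
    (fun _ => hm) (fun _ => hA) (by simpa using hγ)
variable [TopologicalSpace V]

/-- The Hermitian pencil `α ⊗ I - Re Φ(B)`. -/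
noncomputable def pencil {m r : ℕ} (Φ : V →L[ℂ] Matrix (Fin m) (Fin m) ℂ) (α : Matrix (Fin m) (Fin m) ℂ)
    (B : Matrix (Fin r) (Fin r) V) : Matrix (Fin m × Fin r) (Fin m × Fin r) ℂ :=
  α ⊗ₖ (1 : Matrix (Fin r) (Fin r) ℂ) - reM (amplify (⇑Φ) B)

theorem amplify_mconj {m r s : ℕ} (Φ : V →L[ℂ] Matrix (Fin m) (Fin m) ℂ)
    (γ : Matrix (Fin r) (Fin s) ℂ) (A : Matrix (Fin r) (Fin r) V) :
    amplify (⇑Φ) (mconj γ A) =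
      ((1 : Matrix (Fin m) (Fin m) ℂ) ⊗ₖ γ)ᴴ * amplify (⇑Φ) A *
        ((1 : Matrix (Fin m) (Fin m) ℂ) ⊗ₖ γ) := by
  ext ⟨i, a⟩ ⟨j, b⟩
  simp only [amplify, mconj, Matrix.of_apply, map_sum, map_smul, Matrix.mul_apply,
    Fintype.sum_prod_type, Matrix.sum_apply, Matrix.smul_apply, Matrix.conjTranspose_apply,
    Matrix.kroneckerMap_apply, Matrix.one_apply, smul_eq_mul, ite_mul, one_mul, zero_mul,
    mul_ite, mul_zero, apply_ite star, star_zero, Finset.sum_ite_irrel, Finset.sum_const_zero,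
    Finset.sum_ite_eq', Finset.mem_univ, if_true, Finset.sum_mul]
  rw [Finset.sum_comm]
  refine Finset.sum_congr rfl fun k _ => Finset.sum_congr rfl fun l _ => ?_
  ring

theorem reM_conj {ι κ : Type*} [Fintype ι] (G : Matrix ι κ ℂ) (X : Matrix ι ι ℂ) :
    reM (Gᴴ * X * G) = Gᴴ * reM X * G := by
  simp [reM, Matrix.conjTranspose_mul, Matrix.mul_add, Matrix.add_mul, Matrix.mul_assoc]

theorem pencil_mconj {m r s : ℕ} (Φ : V →L[ℂ] Matrix (Fin m) (Fin m) ℂ)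
    (α : Matrix (Fin m) (Fin m) ℂ) (γ : Matrix (Fin r) (Fin s) ℂ) (hγ : γᴴ * γ = 1)
    (A : Matrix (Fin r) (Fin r) V) :
    pencil Φ α (mconj γ A) =
      ((1 : Matrix (Fin m) (Fin m) ℂ) ⊗ₖ γ)ᴴ * pencil Φ α A *
        ((1 : Matrix (Fin m) (Fin m) ℂ) ⊗ₖ γ) := by
  rw [pencil, pencil, amplify_mconj, reM_conj, Matrix.mul_sub, Matrix.sub_mul,
    Matrix.conjTranspose_kronecker, ← Matrix.mul_kronecker_mul, ← Matrix.mul_kronecker_mul]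
  simp [hγ]

theorem pencil_midpoint {m r : ℕ} (Φ : V →L[ℂ] Matrix (Fin m) (Fin m) ℂ)
    (α : Matrix (Fin m) (Fin m) ℂ) (A B : Matrix (Fin r) (Fin r) V) :
    pencil Φ α ((1 / 2 : ℝ) • A + (1 / 2 : ℝ) • B) =
      (2 : ℂ)⁻¹ • (pencil Φ α A + pencil Φ α B) := by
  have h : ∀ v : V, Φ ((1 / 2 : ℝ) • v) = (2 : ℂ)⁻¹ • Φ v := fun v => by
    rw [← Complex.coe_smul, map_smul]
    norm_num
  ext ⟨i, a⟩ ⟨j, b⟩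
  simp only [pencil, reM, amplify, Matrix.sub_apply, Matrix.smul_apply, Matrix.add_apply,
    Matrix.conjTranspose_apply, Matrix.of_apply, map_add, h, smul_eq_mul, star_add, star_mul']
  simp only [star_inv₀, star_ofNat]
  ring

/-- A Hilbert-space subspace has an isometric parametrization by some `ℂ^s`. -/
theorem exists_isometry_of_subspace {n : ℕ} (W : Submodule ℂ (EuclideanSpace ℂ (Fin n))) :
    ∃ γ : Matrix (Fin n) (Fin (Module.finrank ℂ W)) ℂ, γᴴ * γ = 1 ∧
      ∀ w ∈ W, ∃ c, γ *ᵥ c = w.ofLp := by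
  let b := stdOrthonormalBasis ℂ W
  refine ⟨Matrix.of fun k l => (b l : EuclideanSpace ℂ (Fin n)) k, ?_, fun w hw => ?_⟩
  · ext i j
    have h := orthonormal_iff_ite.mp b.orthonormal i j
    rw [Submodule.coe_inner, PiLp.inner_apply] at h
    simp only [Matrix.mul_apply, Matrix.conjTranspose_apply, Matrix.of_apply, Matrix.one_apply]
    rw [← h]
    exact Finset.sum_congr rfl fun k _ => by simp [mul_comm]
  · refine ⟨fun l => b.repr ⟨w, hw⟩ l, ?_⟩
    have h := congrArg (fun u : W => (u : EuclideanSpace ℂ (Fin n))) (b.sum_repr ⟨w, hw⟩)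
    ext k
    have hk := congrArg (fun u : EuclideanSpace ℂ (Fin n) => u k) h
    simp only [Submodule.coe_sum, Submodule.coe_smul, WithLp.ofLp_sum, Finset.sum_apply,
      PiLp.smul_apply, smul_eq_mul] at hk
    rw [← hk]
    simp [Matrix.mulVec, dotProduct, mul_comm]

/-- A nonzero kernel vector of a pencil whose lower-level compressions are positive definite
has full tensor rank. -/
theorem det_ne_zero_of_pencil_mulVec_eq_zero
    {K : ∀ n : ℕ, Set (Matrix (Fin n) (Fin n) V)} (hK : IsMatrixConvex K) {n : ℕ} (hn : 0 < n)
    {Φ : V →L[ℂ] Matrix (Fin n) (Fin n) ℂ} {α : Matrix (Fin n) (Fin n) ℂ}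
    (hpos : ∀ m : ℕ, 0 < m → m < n → ∀ B ∈ K m, (pencil Φ α B).PosDef)
    {A : Matrix (Fin n) (Fin n) V} (hA : A ∈ K n) {x : Fin n × Fin n → ℂ} (hx : x ≠ 0)
    (hker : pencil Φ α A *ᵥ x = 0) :
    (Matrix.of fun i j => x (i, j)).det ≠ 0 := by
  intro hdet
  obtain ⟨v, hv, hXv⟩ := Matrix.exists_mulVec_eq_zero_iff.mpr hdet
  let u : EuclideanSpace ℂ (Fin n) := WithLp.toLp 2 (star v)
  let W : Submodule ℂ (EuclideanSpace ℂ (Fin n)) := (ℂ ∙ u)ᗮ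
  have hu : u ≠ 0 := fun h => hv (by
    have := congrArg WithLp.ofLp h
    simpa [u] using this)
  have hrow : ∀ i, WithLp.toLp 2 (fun j => x (i, j)) ∈ W := fun i => by
    rw [Submodule.mem_orthogonal_singleton_iff_inner_right, PiLp.inner_apply]
    have := congrFun hXv i
    simp only [Matrix.mulVec, dotProduct, Matrix.of_apply, Pi.zero_apply] at this
    rw [← this]
    exact Finset.sum_congr rfl fun k _ => by simp [u, mul_comm]
  have hlt : Module.finrank ℂ W < n := by
    have hW : W ≠ ⊤ := fun h => hu (by
      have : u ∈ W := h ▸ Submodule.mem_top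
      rw [Submodule.mem_orthogonal_singleton_iff_inner_right] at this
      exact inner_self_eq_zero.mp this)
    simpa using Submodule.finrank_lt hW
  obtain ⟨γ, hγ, hrange⟩ := exists_isometry_of_subspace W
  choose c hc using fun i => hrange _ (hrow i)
  let y : Fin n × Fin (Module.finrank ℂ W) → ℂ := fun q => c q.1 q.2
  have hy : ((1 : Matrix (Fin n) (Fin n) ℂ) ⊗ₖ γ) *ᵥ y = x := by
    ext ⟨i, j⟩
    have := congrFun (hc i) j
    simp only [Matrix.mulVec, dotProduct] at this
    simp only [Matrix.mulVec, dotProduct, Fintype.sum_prod_type, Matrix.kroneckerMap_apply,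
      Matrix.one_apply, ite_mul, one_mul, zero_mul, Finset.sum_ite_irrel,
      Finset.sum_const_zero, Finset.sum_ite_eq, Finset.mem_univ, if_true]
    exact this
  have hy0 : y ≠ 0 := fun h => hx (by rw [← hy, h, Matrix.mulVec_zero])
  have hWpos : 0 < Module.finrank ℂ W := by
    obtain ⟨q, -⟩ := Function.ne_iff.mp hy0
    exact q.2.pos
  have hpd := hpos _ hWpos hlt _ (hK.mconj_mem hn hWpos hA hγ)
  have hzero : pencil Φ α (mconj γ A) *ᵥ y = 0 := by
    rw [pencil_mconj Φ α γ hγ, ← Matrix.mulVec_mulVec, hy, ← Matrix.mulVec_mulVec, hker,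
      Matrix.mulVec_zero]
  have := hpd.dotProduct_mulVec_pos hy0
  simp [hzero] at this

/-- Kernels of positive semidefinite matrices intersect to the kernel of the sum. -/
theorem mulVec_eq_zero_of_add_posSemidef {ι : Type*} [Fintype ι] {P Q : Matrix ι ι ℂ}
    (hP : P.PosSemidef) (hQ : Q.PosSemidef) {x : ι → ℂ} (h : (P + Q) *ᵥ x = 0) :
    Q *ᵥ x = 0 := by
  rw [← hQ.dotProduct_mulVec_zero_iff]
  have h0 : star x ⬝ᵥ (P *ᵥ x) + star x ⬝ᵥ (Q *ᵥ x) = 0 := by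
    rw [← dotProduct_add, ← Matrix.add_mulVec, h, dotProduct_zero]
  exact ((add_eq_zero_iff_of_nonneg (hP.dotProduct_mulVec_nonneg x)
    (hQ.dotProduct_mulVec_nonneg x)).mp h0).2

/-- Over a nonempty convex set on which the pencil is positive semidefinite, the common kernel
is attained at a single point. -/
theorem exists_ker_pencil_eq_iInf {m r : ℕ} {Φ : V →L[ℂ] Matrix (Fin m) (Fin m) ℂ}
    {α : Matrix (Fin m) (Fin m) ℂ} {F : Set (Matrix (Fin r) (Fin r) V)}
    (hne : F.Nonempty) (hconv : Convex ℝ F) (hpsd : ∀ A ∈ F, (pencil Φ α A).PosSemidef) :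
    ∃ A₀ ∈ F, LinearMap.ker (pencil Φ α A₀).mulVecLin =
      ⨅ A ∈ F, LinearMap.ker (pencil Φ α A).mulVecLin := by
  obtain ⟨A₀, hA₀, hmin⟩ := WellFounded.has_min
    (InvImage.wf (fun A => LinearMap.ker (pencil Φ α A).mulVecLin)
      (wellFounded_lt (α := Submodule ℂ (Fin m × Fin r → ℂ)))) F hne
  refine ⟨A₀, hA₀, le_antisymm (le_iInf₂ fun A hA => ?_) (iInf₂_le A₀ hA₀)⟩
  have hM : (1 / 2 : ℝ) • A₀ + (1 / 2 : ℝ) • A ∈ F :=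
    hconv hA₀ hA (by norm_num) (by norm_num) (by norm_num)
  have hsum : ∀ x ∈ LinearMap.ker
      (pencil Φ α ((1 / 2 : ℝ) • A₀ + (1 / 2 : ℝ) • A)).mulVecLin,
      (pencil Φ α A₀ + pencil Φ α A) *ᵥ x = 0 := fun x hx => by
    rw [LinearMap.mem_ker, Matrix.mulVecLin_apply, pencil_midpoint, Matrix.smul_mulVec] at hx
    exact (smul_eq_zero.mp hx).resolve_left (by norm_num)
  have hle : LinearMap.ker (pencil Φ α ((1 / 2 : ℝ) • A₀ + (1 / 2 : ℝ) • A)).mulVecLin ≤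
      LinearMap.ker (pencil Φ α A₀).mulVecLin := fun x hx =>
    mulVec_eq_zero_of_add_posSemidef (hpsd A hA) (hpsd A₀ hA₀)
      (by rw [add_comm]; exact hsum x hx)
  rw [← hle.eq_of_not_lt (hmin _ hM)]
  exact fun x hx => mulVec_eq_zero_of_add_posSemidef (hpsd A₀ hA₀) (hpsd A hA) (hsum x hx)

end PencilLemmas

/-- A nonzero space of `n × n` coefficient arrays all of whose nonzero elements are invertible
is one-dimensional over `ℂ`. -/
theorem finrank_eq_one_of_det_ne_zero {n : ℕ} (hn : 0 < n)
    {N : Submodule ℂ (Fin n × Fin n → ℂ)} (hN : N ≠ ⊥)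
    (hdet : ∀ x ∈ N, x ≠ 0 → (Matrix.of fun i j => x (i, j)).det ≠ 0) :
    Module.finrank ℂ N = 1 := by
  have : Nonempty (Fin n) := ⟨⟨0, hn⟩⟩
  obtain ⟨y, hyN, hy⟩ := Submodule.exists_mem_ne_zero_of_ne_bot hN
  refine finrank_eq_one_iff'.mpr ⟨⟨y, hyN⟩, fun h => hy (congrArg Subtype.val h), ?_⟩
  rintro ⟨x, hxN⟩
  let X : Matrix (Fin n) (Fin n) ℂ := Matrix.of fun i j => x (i, j)
  let Y : Matrix (Fin n) (Fin n) ℂ := Matrix.of fun i j => y (i, j)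
  have hY : IsUnit Y.det := (hdet y hyN hy).isUnit
  obtain ⟨c, hc⟩ := Module.End.exists_eigenvalue (Matrix.toLin' (Y⁻¹ * X))
  obtain ⟨v, hv⟩ := hc.exists_hasEigenvector
  refine ⟨c, Subtype.ext ?_⟩
  by_contra hne
  have hsub : x - c • y ≠ 0 := fun h => hne (sub_eq_zero.mp h).symm
  refine hdet _ (N.sub_mem hxN (N.smul_mem c hyN)) hsub
    (Matrix.exists_mulVec_eq_zero_iff.mp ⟨v, hv.2, ?_⟩)
  have h1 : X *ᵥ v = c • (Y *ᵥ v) := by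
    have := congrArg (Y *ᵥ ·) hv.apply_eq_smul
    simpa [Matrix.mulVec_mulVec, ← Matrix.mul_assoc, Matrix.mul_nonsing_inv _ hY,
      Matrix.mulVec_smul] using this
  have h2 : (Matrix.of fun i j => (x - c • y) (i, j)) = X - c • Y := rfl
  rw [h2, Matrix.sub_mulVec, Matrix.smul_mulVec, h1, sub_self]

section Statements

variable {E F' : Type*} [AddCommGroup E] [Module ℂ E] [AddCommGroup F'] [Module ℂ F']
theorem faceExposingPair_kernel_structure
    (p : E →ₗ[ℂ] F' →ₗ[ℂ] ℂ)
    (K : ∀ n : ℕ, Set (Matrix (Fin n) (Fin n) (WeakBilin p)))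
    (hK : IsMatrixConvex K)
    (n : ℕ) (hn : 0 < n)
    (F : Set (Matrix (Fin n) (Fin n) (WeakBilin p))) (hFne : F.Nonempty)
    (hFsub : F ⊆ K n) (hFconv : Convex ℝ F)
    (Φ : WeakBilin p →L[ℂ] Matrix (Fin n) (Fin n) ℂ) (α : Matrix (Fin n) (Fin n) ℂ)
    (hexp : IsFaceExposingPair K F Φ α) :
    (∀ x : Fin n × Fin n → ℂ,
      (x ∈ ⨅ A ∈ F, LinearMap.ker
          (α ⊗ₖ (1 : Matrix (Fin n) (Fin n) ℂ) - reM (amplify (⇑Φ) A)).mulVecLin) →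
      x ≠ 0 →
      Submodule.span ℂ (Set.range fun j : Fin n => fun i : Fin n => x (i, j)) = ⊤) ∧
    Module.finrank ℂ
      ↥(⨅ A ∈ F, LinearMap.ker
          (α ⊗ₖ (1 : Matrix (Fin n) (Fin n) ℂ) - reM (amplify (⇑Φ) A)).mulVecLin) = 1 := by
  obtain ⟨-, hpsd, hpd, hF⟩ := hexp
  have hsub : ∀ x ∈ ⨅ A ∈ F, LinearMap.ker (pencil Φ α A).mulVecLin, x ≠ 0 →
      (Matrix.of fun i j => x (i, j)).det ≠ 0 := fun x hx hx0 => by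
    obtain ⟨A, hA⟩ := hFne
    exact det_ne_zero_of_pencil_mulVec_eq_zero hK hn hpd (hFsub hA) hx0
      ((Submodule.mem_iInf _).mp ((Submodule.mem_iInf _).mp hx A) hA)
  refine ⟨fun x hx hx0 => ?_, finrank_eq_one_of_det_ne_zero hn (fun hbot => ?_) hsub⟩
  · have hunit := (Matrix.isUnit_iff_isUnit_det _).mpr (hsub x hx hx0).isUnit
    have hrange : LinearMap.range (Matrix.of fun i j => x (i, j)).mulVecLin = ⊤ :=
      LinearMap.range_eq_top.mpr (Matrix.mulVec_surjective_iff_isUnit.mpr hunit)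
    rw [Matrix.range_mulVecLin] at hrange
    exact hrange
  · obtain ⟨A₀, hA₀, hker⟩ := exists_ker_pencil_eq_iInf hFne hFconv
      fun A hA => hpsd n hn A (hFsub hA)
    have hsing : ¬ IsUnit (pencil Φ α A₀) := by
      rw [← hF] at hA₀
      exact hA₀.2.2
    exact hsing (Matrix.mulVec_injective_iff_isUnit.mp
      (LinearMap.ker_eq_bot.mp (hker.trans hbot)))

end Statements
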